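/- Fix n > 2 and perplexity ρ ∈ (1, n−1). For ε > 0, let Δ_ε := {X = {x_1,…,x_n} ⊂ ℝ^{n−1} : ‖x_i − x_j‖² ∈ [1−ε, 1+ε] for all i ≠ j} be the set of ε-perturbations of a regular unit simplex. Then for every ε > 0, IM_ρ = TSNE_ρ(Δ_ε), where TSNE_ρ(Δ_ε) = ⋃_{X ∈ Δ_ε} TSNE_ρ(X); that is, the datasets arbitrarily close to a regular unit simplex already generate all possible stationary t-SNE outputs. -/

import Mathlib

open scoped BigOperators RealInnerProductSpace
noncomputable section

namespace TSNEPaper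

variable {n k : ℕ} {E F : Type*}

/-- The set of nearest neighbors of point `i` (used for the `σ = 0` limit of the
conditional affinity). -/
def nearestSet [NormedAddCommGroup E] (X : Fin n → E) (i : Fin n) : Finset (Fin n) :=
  (Finset.univ.erase i).filter fun j => ∀ l ∈ Finset.univ.erase i, ‖X i - X j‖ ≤ ‖X i - X l‖

/-- Conditional t-SNE affinity `P_{j|i}(X; σ)`.  For `σ = 0` we take the limiting value
as `σ → 0⁺`, which puts equal mass on the nearest neighbors of `i`. -/
def condAffinity [NormedAddCommGroup E] (X : Fin n → E) (σ : ℝ) (i j : Fin n) : ℝ :=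
  if j = i then 0
  else if σ = 0 then (if j ∈ nearestSet X i then ((nearestSet X i).card : ℝ)⁻¹ else 0)
  else Real.exp (-‖X i - X j‖ ^ 2 / (2 * σ ^ 2)) /
      ∑ l ∈ Finset.univ.erase i, Real.exp (-‖X i - X l‖ ^ 2 / (2 * σ ^ 2))

/-- Base-2 Shannon entropy of a distribution on `Fin n`. -/
def entropy2 (p : Fin n → ℝ) : ℝ := -∑ j, p j * Real.logb 2 (p j)

/-- `σ` is a perplexity-`ρ`-calibrated bandwidth for point `i`: it is nonnegative and
minimizes the gap between the entropy of `P_{·|i}(X;σ)` and `log₂ ρ`. -/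
def IsCalibrated [NormedAddCommGroup E] (X : Fin n → E) (ρ : ℝ) (i : Fin n) (σ : ℝ) : Prop :=
  0 ≤ σ ∧ ∀ σ' : ℝ, 0 ≤ σ' →
    |entropy2 (condAffinity X σ i) - Real.logb 2 ρ| ≤
      |entropy2 (condAffinity X σ' i) - Real.logb 2 ρ|

/-- The calibrated bandwidth `σ_i^*` (well defined by uniqueness of the minimizer). -/
def sigmaStar [NormedAddCommGroup E] (X : Fin n → E) (ρ : ℝ) (i : Fin n) : ℝ :=
  Classical.epsilon (IsCalibrated X ρ i)

/-- Symmetrized input affinity `P_{ij}(X)`. -/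
def inAffinity [NormedAddCommGroup E] (X : Fin n → E) (ρ : ℝ) (i j : Fin n) : ℝ :=
  if i = j then 0
  else (condAffinity X (sigmaStar X ρ j) j i + condAffinity X (sigmaStar X ρ i) i j) / (2 * n)

/-- Output affinity `Q_{ij}(Y)`. -/
def outAffinity [NormedAddCommGroup F] (Y : Fin n → F) (i j : Fin n) : ℝ :=
  if i = j then 0
  else (1 + ‖Y i - Y j‖ ^ 2)⁻¹ /
    ∑ p ∈ Finset.univ.offDiag, (1 + ‖Y p.1 - Y p.2‖ ^ 2)⁻¹

/-- The t-SNE loss `L_X(Y) = KL(P(X) ‖ Q(Y))`. -/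
def tsneLoss {d : ℕ} [NormedAddCommGroup E] (X : Fin n → E) (ρ : ℝ)
    (Y : Fin n → EuclideanSpace ℝ (Fin d)) : ℝ :=
  ∑ p ∈ Finset.univ.offDiag,
    inAffinity X ρ p.1 p.2 * Real.log (inAffinity X ρ p.1 p.2 / outAffinity Y p.1 p.2)

/-- The set of stationary t-SNE outputs in `ℝ^d` for input `X` and perplexity `ρ`. -/
def TSNE [NormedAddCommGroup E] (d : ℕ) (ρ : ℝ) (X : Fin n → E) :
    Set (Fin n → EuclideanSpace ℝ (Fin d)) :=
  {Y : Fin n → EuclideanSpace ℝ (Fin d) | fderiv ℝ (tsneLoss X ρ) Y = 0}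

/-- The image of t-SNE: all stationary outputs over all `n`-point inputs in `ℝ^{n-1}`. -/
def IMTSNE (n d : ℕ) (ρ : ℝ) : Set (Fin n → EuclideanSpace ℝ (Fin d)) :=
  ⋃ X : Fin n → EuclideanSpace ℝ (Fin (n - 1)), TSNE d ρ X

/-- The `m`-th cluster of the partition of `[n]` encoded by the labelling `ℓ`. -/
def cluster (ℓ : Fin n → Fin k) (m : Fin k) : Finset (Fin n) :=
  Finset.univ.filter fun i => ℓ i = m

/-- Average within-cluster distance `a(i)`. -/
def aScore [NormedAddCommGroup E] (X : Fin n → E) (ℓ : Fin n → Fin k) (i : Fin n) : ℝ :=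
  (∑ j ∈ cluster ℓ (ℓ i), ‖X i - X j‖) / (((cluster ℓ (ℓ i)).card : ℝ) - 1)

/-- Closest average across-cluster distance `b(i)`. -/
def bScore [NormedAddCommGroup E] (X : Fin n → E) (ℓ : Fin n → Fin k) (i : Fin n) : ℝ :=
  sInf {r : ℝ | ∃ m : Fin k, m ≠ ℓ i ∧
    r = (∑ j ∈ cluster ℓ m, ‖X i - X j‖) / ((cluster ℓ m).card : ℝ)}

/-- Silhouette score of point `i`. -/
def silhouette [NormedAddCommGroup E] (X : Fin n → E) (ℓ : Fin n → Fin k) (i : Fin n) : ℝ :=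
  if (cluster ℓ (ℓ i)).card = 1 then 0
  else (bScore X ℓ i - aScore X ℓ i) / max (aScore X ℓ i) (bScore X ℓ i)

/-- Average silhouette score `S̄(X; C₁,…,C_k)`. -/
def avgSilhouette [NormedAddCommGroup E] (X : Fin n → E) (ℓ : Fin n → Fin k) : ℝ :=
  (∑ i, silhouette X ℓ i) / (n : ℝ)

/-- Centroid `E(S)` of the points indexed by `S`. -/
def centroid [NormedAddCommGroup E] [NormedSpace ℝ E] (X : Fin n → E)
    (S : Finset (Fin n)) : E :=
  ((S.card : ℝ))⁻¹ • ∑ i ∈ S, X i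

/-- Numerator (between-cluster term) of the Calinski–Harabasz index. -/
def chNum [NormedAddCommGroup E] [NormedSpace ℝ E] (X : Fin n → E) (ℓ : Fin n → Fin k) : ℝ :=
  ((k : ℝ) - 1)⁻¹ *
    ∑ m : Fin k, ((cluster ℓ m).card : ℝ) *
      ‖centroid X (cluster ℓ m) - centroid X Finset.univ‖ ^ 2

/-- Denominator (within-cluster term) of the Calinski–Harabasz index. -/
def chDen [NormedAddCommGroup E] [NormedSpace ℝ E] (X : Fin n → E) (ℓ : Fin n → Fin k) : ℝ :=
  ((n : ℝ) - (k : ℝ))⁻¹ *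
    ∑ m : Fin k, ∑ i ∈ cluster ℓ m, ‖X i - centroid X (cluster ℓ m)‖ ^ 2

/-- Calinski–Harabasz index, valued in `[0,∞]`, with the conventions `CH = 1` when both
numerator and denominator vanish and `CH = ∞` when only the denominator vanishes. -/
def CHindex [NormedAddCommGroup E] [NormedSpace ℝ E] (X : Fin n → E) (ℓ : Fin n → Fin k) :
    EReal :=
  if chDen X ℓ = 0 then (if chNum X ℓ = 0 then 1 else ⊤)
  else ((chNum X ℓ / chDen X ℓ : ℝ) : EReal)

/-- Minimum between-cluster distance (numerator of the Dunn index). -/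
def diNum [NormedAddCommGroup E] (X : Fin n → E) (ℓ : Fin n → Fin k) : ℝ :=
  sInf {r : ℝ | ∃ i j : Fin n, ℓ i ≠ ℓ j ∧ r = ‖X i - X j‖}

/-- Maximum within-cluster distance (denominator of the Dunn index). -/
def diDen [NormedAddCommGroup E] (X : Fin n → E) (ℓ : Fin n → Fin k) : ℝ :=
  sSup {r : ℝ | ∃ i j : Fin n, ℓ i = ℓ j ∧ r = ‖X i - X j‖}

/-- Dunn index, valued in `[0,∞]`, with the conventions `DI = 1` when both numerator and
denominator vanish and `DI = ∞` when only the denominator vanishes. -/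
def DIindex [NormedAddCommGroup E] (X : Fin n → E) (ℓ : Fin n → Fin k) : EReal :=
  if diDen X ℓ = 0 then (if diNum X ℓ = 0 then 1 else ⊤)
  else ((diNum X ℓ / diDen X ℓ : ℝ) : EReal)

/-- `Y` is an `(α, Y i₀)`-outlier configuration: there is a hyperplane (with unit normal `v`)
separating `Y i₀` from the remaining points with margin width at least
`α · max{1, diam(Y ∖ {Y i₀})}`. -/
def IsOutlierConfig [NormedAddCommGroup F] [InnerProductSpace ℝ F] (Y : Fin n → F)
    (i0 : Fin n) (α : ℝ) : Prop :=
  0 < α ∧ ∃ v : F, ‖v‖ = 1 ∧ ∀ i : Fin n, i ≠ i0 →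
    α * max 1 (Metric.diam (Y '' {i : Fin n | i ≠ i0})) ≤ ⟪Y i - Y i0, v⟫

/-- The outlier number `α(Y, y₀)`: the largest `α` for which `Y` is an `(α, Y i₀)`-outlier
configuration (`0` if there is none). -/
def outlierNumber [NormedAddCommGroup F] [InnerProductSpace ℝ F] (Y : Fin n → F)
    (i0 : Fin n) : ℝ :=
  sSup {α : ℝ | IsOutlierConfig Y i0 α}


/-! ### Gibbs weights on a finite set -/

/-- Gibbs weights at inverse temperature `β`. -/
def gw {ι : Type*} (s : Finset ι) (a : ι → ℝ) (β : ℝ) (j : ι) : ℝ :=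
  Real.exp (-(β * a j)) / ∑ l ∈ s, Real.exp (-(β * a l))

/-- Natural entropy on a finset. -/
def ent {ι : Type*} (s : Finset ι) (p : ι → ℝ) : ℝ := ∑ j ∈ s, Real.negMulLog (p j)

lemma gZ_pos {ι : Type*} {s : Finset ι} (hs : s.Nonempty) (a : ι → ℝ) (β : ℝ) :
    0 < ∑ l ∈ s, Real.exp (-(β * a l)) :=
  Finset.sum_pos (fun _ _ => Real.exp_pos _) hs

lemma gw_pos {ι : Type*} {s : Finset ι} (hs : s.Nonempty) (a : ι → ℝ) (β : ℝ) (j : ι) :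
    0 < gw s a β j := div_pos (Real.exp_pos _) (gZ_pos hs a β)

lemma gw_sum {ι : Type*} {s : Finset ι} (hs : s.Nonempty) (a : ι → ℝ) (β : ℝ) :
    ∑ j ∈ s, gw s a β j = 1 := by
  unfold gw
  rw [← Finset.sum_div, div_self (gZ_pos hs a β).ne']

lemma log_gw {ι : Type*} {s : Finset ι} (hs : s.Nonempty) (a : ι → ℝ) (β : ℝ) (j : ι) :
    Real.log (gw s a β j) = -(β * a j) - Real.log (∑ l ∈ s, Real.exp (-(β * a l))) := by
  unfold gw
  rw [Real.log_div (Real.exp_pos _).ne' (gZ_pos hs a β).ne', Real.log_exp]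

lemma gw_term {ι : Type*} {s : Finset ι} (hs : s.Nonempty) (a : ι → ℝ) (β : ℝ) (j : ι)
    (x : ℝ) (hx : 0 ≤ x) :
    Real.negMulLog x ≤ x * (-Real.log (gw s a β j)) + (gw s a β j - x) := by
  have hw := gw_pos hs a β j
  rcases hx.eq_or_lt with h | h
  · subst h; simp [hw.le]
  · have h1 := Real.log_le_sub_one_of_pos (div_pos hw h)
    rw [Real.log_div hw.ne' h.ne'] at h1
    have h2 := mul_le_mul_of_nonneg_left h1 h.le
    have h3 : x * (gw s a β j / x - 1) = gw s a β j - x := by field_simp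
    rw [h3] at h2
    unfold Real.negMulLog
    linarith

lemma gw_term_lt {ι : Type*} {s : Finset ι} (hs : s.Nonempty) (a : ι → ℝ) (β : ℝ) (j : ι)
    (x : ℝ) (h : 0 < x) (hne : x ≠ gw s a β j) :
    Real.negMulLog x < x * (-Real.log (gw s a β j)) + (gw s a β j - x) := by
  have hw := gw_pos hs a β j
  have h1 := Real.log_lt_sub_one_of_pos (div_pos hw h)
    (by rw [Ne, div_eq_one_iff_eq h.ne']; exact fun h => hne h.symm)
  rw [Real.log_div hw.ne' h.ne'] at h1
  have h2 := mul_lt_mul_of_pos_left h1 h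
  have h3 : x * (gw s a β j / x - 1) = gw s a β j - x := by field_simp
  rw [h3] at h2
  unfold Real.negMulLog
  linarith

lemma gw_rhs {ι : Type*} {s : Finset ι} (hs : s.Nonempty) (a : ι → ℝ) (β : ℝ)
    (q : ι → ℝ) (hq1 : ∑ j ∈ s, q j = 1) :
    ∑ j ∈ s, (q j * (-Real.log (gw s a β j)) + (gw s a β j - q j))
      = β * ∑ j ∈ s, q j * a j + Real.log (∑ l ∈ s, Real.exp (-(β * a l))) := by
  rw [Finset.sum_add_distrib, Finset.sum_sub_distrib, hq1, gw_sum hs, sub_self, add_zero]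
  simp_rw [log_gw hs]
  set L := Real.log (∑ l ∈ s, Real.exp (-(β * a l)))
  have : ∀ j ∈ s, q j * -(-(β * a j) - L) = β * (q j * a j) + q j * L := by
    intros; ring
  rw [Finset.sum_congr rfl this, Finset.sum_add_distrib, ← Finset.mul_sum, ← Finset.sum_mul,
    hq1, one_mul]

lemma ent_gw {ι : Type*} {s : Finset ι} (hs : s.Nonempty) (a : ι → ℝ) (β : ℝ) :
    ent s (gw s a β) = β * ∑ j ∈ s, gw s a β j * a j +
      Real.log (∑ l ∈ s, Real.exp (-(β * a l))) := by
  rw [← gw_rhs hs a β _ (gw_sum hs a β)]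
  unfold ent
  refine Finset.sum_congr rfl fun j _ => ?_
  unfold Real.negMulLog
  ring

lemma gibbs_le {ι : Type*} {s : Finset ι} (hs : s.Nonempty) (a : ι → ℝ) (β : ℝ)
    (q : ι → ℝ) (hq : ∀ j ∈ s, 0 ≤ q j) (hq1 : ∑ j ∈ s, q j = 1) :
    ent s q - ent s (gw s a β) ≤ β * (∑ j ∈ s, q j * a j - ∑ j ∈ s, gw s a β j * a j) := by
  have h1 : ent s q ≤ _ := Finset.sum_le_sum fun j hj => gw_term hs a β j (q j) (hq j hj)
  rw [gw_rhs hs a β q hq1] at h1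
  rw [ent_gw hs]
  linarith

lemma gibbs_lt {ι : Type*} {s : Finset ι} (hs : s.Nonempty) (a : ι → ℝ) (β : ℝ)
    (q : ι → ℝ) (hq : ∀ j ∈ s, 0 ≤ q j) (hq1 : ∑ j ∈ s, q j = 1)
    (hne : ∃ j ∈ s, 0 < q j ∧ q j ≠ gw s a β j) :
    ent s q - ent s (gw s a β) < β * (∑ j ∈ s, q j * a j - ∑ j ∈ s, gw s a β j * a j) := by
  have h1 : ent s q < _ := Finset.sum_lt_sum
    (fun j hj => gw_term hs a β j (q j) (hq j hj))
    (by
      obtain ⟨j, hj, h0, h⟩ := hne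
      exact ⟨j, hj, gw_term_lt hs a β j (q j) h0 h⟩)
  rw [gw_rhs hs a β q hq1] at h1
  rw [ent_gw hs]
  linarith

lemma gw_ne {ι : Type*} {s : Finset ι} (hs : s.Nonempty) (a : ι → ℝ) {β₁ β₂ : ℝ}
    (hβ : β₁ ≠ β₂) (ha : ∃ j ∈ s, ∃ l ∈ s, a j ≠ a l) :
    ∃ j ∈ s, gw s a β₂ j ≠ gw s a β₁ j := by
  by_contra! hcon
  obtain ⟨j, hj, l, hl, hjl⟩ := ha
  have h1 := congrArg Real.log (hcon j hj)
  have h2 := congrArg Real.log (hcon l hl)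
  rw [log_gw hs, log_gw hs] at h1 h2
  have : (β₁ - β₂) * (a j - a l) = 0 := by linarith
  rcases mul_eq_zero.1 this with h | h
  · exact hβ (sub_eq_zero.1 h)
  · exact hjl (sub_eq_zero.1 h)

lemma ent_gw_lt {ι : Type*} {s : Finset ι} (hs : s.Nonempty) (a : ι → ℝ) {β₁ β₂ : ℝ}
    (h0 : 0 ≤ β₁) (hβ : β₁ < β₂) (ha : ∃ j ∈ s, ∃ l ∈ s, a j ≠ a l) :
    ent s (gw s a β₂) < ent s (gw s a β₁) := by
  obtain ⟨j, hj, hne⟩ := gw_ne hs a hβ.ne ha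
  have h1 := gibbs_lt hs a β₁ (gw s a β₂) (fun j _ => (gw_pos hs a β₂ j).le) (gw_sum hs a β₂)
    ⟨j, hj, gw_pos hs a β₂ j, hne⟩
  have h2 := gibbs_le hs a β₂ (gw s a β₁) (fun j _ => (gw_pos hs a β₁ j).le) (gw_sum hs a β₁)
  set E1 := ∑ j ∈ s, gw s a β₁ j * a j
  set E2 := ∑ j ∈ s, gw s a β₂ j * a j
  have h3 : 0 < (β₂ - β₁) * (E1 - E2) := by nlinarith
  have h4 : 0 < E1 - E2 := (mul_pos_iff_of_pos_left (sub_pos.2 hβ)).1 h3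
  nlinarith

/-- The minimizers of `a` on `s`. -/
def amin {ι : Type*} (s : Finset ι) (a : ι → ℝ) : Finset ι :=
  open scoped Classical in s.filter fun j => ∀ l ∈ s, a j ≤ a l

/-- The zero temperature distribution. -/
def g0 {ι : Type*} (s : Finset ι) (a : ι → ℝ) (j : ι) : ℝ :=
  open scoped Classical in if j ∈ amin s a then ((amin s a).card : ℝ)⁻¹ else 0

lemma mem_amin {ι : Type*} {s : Finset ι} {a : ι → ℝ} {j : ι} :
    j ∈ amin s a ↔ j ∈ s ∧ ∀ l ∈ s, a j ≤ a l := by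
  classical
  unfold amin
  rw [Finset.mem_filter]

lemma amin_nonempty {ι : Type*} {s : Finset ι} (hs : s.Nonempty) (a : ι → ℝ) :
    (amin s a).Nonempty := by
  obtain ⟨j, hj, h⟩ := Finset.exists_min_image s a hs
  exact ⟨j, mem_amin.2 ⟨hj, h⟩⟩

lemma g0_nonneg {ι : Type*} (s : Finset ι) (a : ι → ℝ) (j : ι) : 0 ≤ g0 s a j := by
  unfold g0
  split_ifs <;> positivity

lemma g0_sum_mul {ι : Type*} (s : Finset ι) (a f : ι → ℝ) :
    ∑ j ∈ s, g0 s a j * f j = ∑ j ∈ amin s a, ((amin s a).card : ℝ)⁻¹ * f j := by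
  classical
  have hsub : amin s a ⊆ s := fun j hj => (mem_amin.1 hj).1
  rw [← Finset.sum_subset hsub]
  · refine Finset.sum_congr rfl fun j hj => ?_
    simp [g0, hj]
  · intro j _ hj
    simp [g0, hj]

lemma g0_sum {ι : Type*} {s : Finset ι} (hs : s.Nonempty) (a : ι → ℝ) :
    ∑ j ∈ s, g0 s a j = 1 := by
  have h := g0_sum_mul s a (fun _ => 1)
  simp only [mul_one, Finset.sum_const, nsmul_eq_mul] at h
  rw [h, mul_inv_cancel₀]
  exact_mod_cast (amin_nonempty hs a).card_pos.ne'

lemma ent_g0_lt {ι : Type*} {s : Finset ι} (hs : s.Nonempty) (a : ι → ℝ) {β : ℝ}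
    (hβ : 0 < β) (ha : ∃ j ∈ s, ∃ l ∈ s, a j ≠ a l) :
    ent s (g0 s a) < ent s (gw s a β) := by
  have h1 := gibbs_le hs a β (g0 s a) (fun j _ => g0_nonneg s a j) (g0_sum hs a)
  obtain ⟨m, hm⟩ := amin_nonempty hs a
  have hm' := mem_amin.1 hm
  have hE0 : ∑ j ∈ s, g0 s a j * a j = a m := by
    have h2 : ∑ j ∈ s, g0 s a j * a j = ∑ j ∈ s, g0 s a j * a m := by
      rw [g0_sum_mul s a a, g0_sum_mul s a (fun _ => a m)]
      refine Finset.sum_congr rfl fun j hj => ?_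
      rw [le_antisymm ((mem_amin.1 hj).2 m hm'.1) (hm'.2 j (mem_amin.1 hj).1)]
    rw [h2, ← Finset.sum_mul, g0_sum hs, one_mul]
  have hE1 : a m < ∑ j ∈ s, gw s a β j * a j := by
    have : a m = ∑ j ∈ s, gw s a β j * a m := by rw [← Finset.sum_mul, gw_sum hs, one_mul]
    rw [this]
    refine Finset.sum_lt_sum
      (fun j hj => mul_le_mul_of_nonneg_left (hm'.2 j hj) (gw_pos hs a β j).le) ?_
    obtain ⟨j, hj, l, hl, hjl⟩ := ha
    have : a m < a j ∨ a m < a l := by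
      by_contra! hc
      exact hjl (le_antisymm (hc.1.trans (hm'.2 l hl)) (hc.2.trans (hm'.2 j hj)))
    rcases this with h | h
    · exact ⟨j, hj, mul_lt_mul_of_pos_left h (gw_pos hs a β j)⟩
    · exact ⟨l, hl, mul_lt_mul_of_pos_left h (gw_pos hs a β l)⟩
  rw [hE0] at h1
  nlinarith

lemma gw_affine {ι : Type*} {s : Finset ι} {a b : ι → ℝ} {c δ β γ : ℝ}
    (hβ : γ * δ = β) (hab : ∀ j ∈ s, b j = c + δ * a j) {j : ι} (hj : j ∈ s) :
    gw s b γ j = gw s a β j := by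
  have h : ∀ j ∈ s, Real.exp (-(γ * b j)) = Real.exp (-(γ * c)) * Real.exp (-(β * a j)) := by
    intro j hj
    rw [← Real.exp_add, hab j hj, ← hβ]
    congr 1; ring
  unfold gw
  rw [h j hj, Finset.sum_congr rfl h, ← Finset.mul_sum,
    mul_div_mul_left _ _ (Real.exp_pos _).ne']

lemma tendsto_gw {ι : Type*} {s : Finset ι} (hs : s.Nonempty) (a : ι → ℝ) {j : ι} (hj : j ∈ s) :
    Filter.Tendsto (fun β => gw s a β j) Filter.atTop (nhds (g0 s a j)) := by
  classical
  obtain ⟨m, hm⟩ := amin_nonempty hs a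
  have hm' := mem_amin.1 hm
  have hgw : ∀ β, gw s a β j = gw s (fun l => a l - a m) β j := fun β =>
    gw_affine (c := a m) (δ := 1) (by ring) (fun l _ => by ring) hj
  have hlim : ∀ l ∈ s, Filter.Tendsto (fun β : ℝ => Real.exp (-(β * (a l - a m)))) Filter.atTop
      (nhds (if l ∈ amin s a then 1 else 0)) := by
    intro l hl
    split_ifs with h
    · have : a l = a m := le_antisymm ((mem_amin.1 h).2 m hm'.1) (hm'.2 l hl)
      simp [this]
    · have hlt : 0 < a l - a m := by
        rcases (hm'.2 l hl).eq_or_lt with h' | h'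
        · exact absurd (mem_amin.2 ⟨hl, fun k hk => h' ▸ hm'.2 k hk⟩) h
        · linarith
      exact Real.tendsto_exp_neg_atTop_nhds_zero.comp
        (Filter.tendsto_id.atTop_mul_const hlt)
  simp_rw [hgw]
  have hsub : amin s a ⊆ s := fun j hj => (mem_amin.1 hj).1
  have hden : ∑ l ∈ s, (if l ∈ amin s a then (1:ℝ) else 0) = (amin s a).card := by
    rw [Finset.sum_ite_mem, Finset.inter_eq_right.2 hsub]; simp
  have hZ := tendsto_finsetSum s hlim
  rw [hden] at hZ
  have := (hlim j hj).div hZ (by exact_mod_cast (amin_nonempty hs a).card_pos.ne')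
  have hlimit : g0 s a j = (if j ∈ amin s a then 1 else 0) / ((amin s a).card : ℝ) := by
    unfold g0
    split_ifs <;> simp
  rw [hlimit]
  exact this

lemma tendsto_ent {ι : Type*} {s : Finset ι} (hs : s.Nonempty) (a : ι → ℝ) :
    Filter.Tendsto (fun β => ent s (gw s a β)) Filter.atTop (nhds (ent s (g0 s a))) :=
  tendsto_finsetSum s fun _ hj =>
    (Real.continuous_negMulLog.tendsto _).comp (tendsto_gw hs a hj)

lemma continuous_ent {ι : Type*} {s : Finset ι} (hs : s.Nonempty) (a : ι → ℝ) :
    Continuous (fun β => ent s (gw s a β)) := by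
  unfold ent
  refine continuous_finsetSum s fun j _ => Real.continuous_negMulLog.comp ?_
  unfold gw
  exact Continuous.div (by fun_prop) (by fun_prop) fun β => (gZ_pos hs a β).ne'

lemma ent_zero {ι : Type*} {s : Finset ι} (hs : s.Nonempty) (a : ι → ℝ) :
    ent s (gw s a 0) = Real.log s.card := by
  rw [ent_gw hs]; simp

/-- Conditional affinities, as a function of the squared distances. -/
def gg {ι : Type*} (s : Finset ι) (a : ι → ℝ) (σ : ℝ) (j : ι) : ℝ :=
  open scoped Classical in
  if j ∈ s then (if σ = 0 then g0 s a j else gw s a ((2 * σ ^ 2)⁻¹) j) else 0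

lemma ent_congr {ι : Type*} {s : Finset ι} {p q : ι → ℝ} (h : ∀ j ∈ s, p j = q j) :
    ent s p = ent s q := Finset.sum_congr rfl fun j hj => by rw [h j hj]

lemma ent_gg_zero {ι : Type*} (s : Finset ι) (a : ι → ℝ) :
    ent s (gg s a 0) = ent s (g0 s a) := ent_congr fun j hj => by simp [gg, hj]

lemma ent_gg_pos {ι : Type*} (s : Finset ι) (a : ι → ℝ) {σ : ℝ} (hσ : σ ≠ 0) :
    ent s (gg s a σ) = ent s (gw s a ((2 * σ ^ 2)⁻¹)) :=
  ent_congr fun j hj => by simp [gg, hj, hσ]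

lemma ent_gg_strictMono {ι : Type*} {s : Finset ι} (hs : s.Nonempty) (a : ι → ℝ)
    (ha : ∃ j ∈ s, ∃ l ∈ s, a j ≠ a l) {σ τ : ℝ} (h0 : 0 ≤ σ) (h : σ < τ) :
    ent s (gg s a σ) < ent s (gg s a τ) := by
  have hτ : 0 < τ := h0.trans_lt h
  rw [ent_gg_pos s a hτ.ne']
  rcases h0.eq_or_lt with h' | h'
  · subst h'
    rw [ent_gg_zero]
    exact ent_g0_lt hs a (by positivity) ha
  · rw [ent_gg_pos s a h'.ne']
    refine ent_gw_lt hs a (by positivity) ?_ ha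
    gcongr

lemma gg_const {ι : Type*} {s : Finset ι} (a : ι → ℝ)
    (ha : ∀ j ∈ s, ∀ l ∈ s, a j = a l) (σ : ℝ) : gg s a σ = gg s a 0 := by
  classical
  funext j
  unfold gg
  by_cases hj : j ∈ s
  · by_cases hσ : σ = 0
    · simp [hσ]
    · have hN : amin s a = s := by
        ext l; rw [mem_amin]
        exact ⟨fun h => h.1, fun h => ⟨h, fun k hk => (ha l h k hk).le⟩⟩
      simp only [hj, hσ, if_true, if_false, g0, hN]
      unfold gw
      rw [Finset.sum_congr rfl (fun l hl => by rw [ha l hl j hj]), Finset.sum_const, nsmul_eq_mul]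
      field_simp
  · simp [hj]

lemma gg_affine {ι : Type*} {s : Finset ι} {a b : ι → ℝ} {c t : ℝ} (ht : 0 < t)
    (hab : ∀ j ∈ s, b j = c + t ^ 2 * a j) (σ : ℝ) :
    gg s b (t * σ) = gg s a σ := by
  classical
  funext j
  unfold gg
  by_cases hj : j ∈ s
  · by_cases hσ : σ = 0
    · have hN : amin s b = amin s a := by
        ext l
        rw [mem_amin, mem_amin]
        refine and_congr_right fun hl => forall₂_congr fun k hk => ?_
        rw [hab l hl, hab k hk, add_le_add_iff_left, mul_le_mul_iff_right₀ (by positivity)]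
      simp [hσ, g0, hN]
    · simp only [hj, hσ, mul_eq_zero, ht.ne', or_self, if_true, if_false]
      refine gw_affine (c := c) (δ := t ^ 2) ?_ hab hj
      field_simp
  · simp [hj]

/-- Calibration in terms of natural entropy. -/
def Cal {ι : Type*} (s : Finset ι) (a : ι → ℝ) (c σ : ℝ) : Prop :=
  0 ≤ σ ∧ ∀ σ' : ℝ, 0 ≤ σ' → |ent s (gg s a σ) - c| ≤ |ent s (gg s a σ') - c|

lemma cal_exists {ι : Type*} {s : Finset ι} (hs : s.Nonempty) (a : ι → ℝ) {c : ℝ}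
    (hc : c < Real.log s.card) : ∃ σ, Cal s a c σ := by
  by_cases ha : ∃ j ∈ s, ∃ l ∈ s, a j ≠ a l
  · rcases le_or_gt c (ent s (g0 s a)) with h | h
    · refine ⟨0, le_rfl, fun σ' hσ' => ?_⟩
      have hle : ent s (gg s a 0) ≤ ent s (gg s a σ') := by
        rcases hσ'.eq_or_lt with h' | h'
        · rw [h']
        · exact (ent_gg_strictMono hs a ha le_rfl h').le
      rw [← ent_gg_zero] at h
      rw [abs_of_nonneg (by linarith), abs_of_nonneg (by linarith)]
      linarith
    · obtain ⟨B, hB, hB0⟩ := (((tendsto_ent hs a).eventually (gt_mem_nhds h)).and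
        (Filter.eventually_ge_atTop 0)).exists
      obtain ⟨β, hβ, hβc⟩ := intermediate_value_Icc' hB0 (continuous_ent hs a).continuousOn
        (⟨hB.le, by rw [ent_zero hs]; exact hc.le⟩ : c ∈ Set.Icc _ _)
      have hβ0 : 0 < β := by
        rcases hβ.1.eq_or_lt with h' | h'
        · subst h'
          simp only [ent_zero hs] at hβc
          linarith
        · exact h'
      have hσ : 0 < Real.sqrt ((2 * β)⁻¹) := Real.sqrt_pos.2 (by positivity)
      refine ⟨Real.sqrt ((2 * β)⁻¹), hσ.le, fun σ' _ => ?_⟩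
      have : (2 * Real.sqrt ((2 * β)⁻¹) ^ 2)⁻¹ = β := by
        rw [Real.sq_sqrt (by positivity)]; field_simp
      rw [ent_gg_pos s a hσ.ne', this]
      simp only at hβc
      rw [hβc, sub_self, abs_zero]
      exact abs_nonneg _
  · push Not at ha
    refine ⟨0, le_rfl, fun σ' _ => ?_⟩
    rw [gg_const a ha σ']

lemma cal_unique {ι : Type*} {s : Finset ι} (hs : s.Nonempty) (a : ι → ℝ) {c σ τ : ℝ}
    (h1 : Cal s a c σ) (h2 : Cal s a c τ) : gg s a σ = gg s a τ := by
  by_cases ha : ∃ j ∈ s, ∃ l ∈ s, a j ≠ a l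
  · suffices h : ∀ σ τ, Cal s a c σ → Cal s a c τ → ¬ σ < τ by
      rw [le_antisymm (not_lt.1 (h τ σ h2 h1)) (not_lt.1 (h σ τ h1 h2))]
    intro σ τ h1 h2 hlt
    have hm0 : 0 ≤ (σ + τ) / 2 := by linarith [h1.1, h2.1]
    have e1 := ent_gg_strictMono hs a ha h1.1 (show σ < (σ + τ) / 2 by linarith)
    have e2 := ent_gg_strictMono hs a ha hm0 (show (σ + τ) / 2 < τ by linarith)
    have i1 := h1.2 _ hm0
    have i2 := h2.2 _ hm0
    rcases abs_cases (ent s (gg s a σ) - c) with ⟨_, _⟩ | ⟨_, _⟩ <;>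
    rcases abs_cases (ent s (gg s a τ) - c) with ⟨_, _⟩ | ⟨_, _⟩ <;>
    rcases abs_cases (ent s (gg s a ((σ + τ) / 2)) - c) with ⟨_, _⟩ | ⟨_, _⟩ <;>
    linarith
  · push Not at ha
    rw [gg_const a ha σ, gg_const a ha τ]

/-! ### Link with the definitions -/

lemma nearestSet_eq [NormedAddCommGroup E] (X : Fin n → E) (i : Fin n) :
    nearestSet X i = amin (Finset.univ.erase i) (fun j => ‖X i - X j‖ ^ 2) := by
  ext j
  rw [mem_amin]
  unfold nearestSet
  rw [Finset.mem_filter]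
  refine and_congr_right fun _ => forall₂_congr fun l _ => ?_
  exact (pow_le_pow_iff_left₀ (norm_nonneg _) (norm_nonneg _) two_ne_zero).symm

lemma condAffinity_eq [NormedAddCommGroup E] (X : Fin n → E) (σ : ℝ) (i : Fin n) :
    condAffinity X σ i = gg (Finset.univ.erase i) (fun j => ‖X i - X j‖ ^ 2) σ := by
  funext j
  unfold condAffinity gg
  by_cases hj : j = i
  · simp [hj]
  · by_cases hσ : σ = 0
    · simp only [hj, hσ, if_false, if_true, Finset.mem_erase, ne_eq, not_false_eq_true,
        Finset.mem_univ, and_self, g0, nearestSet_eq]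
      split_ifs <;> rfl
    · have : ∀ x : ℝ, -x / (2 * σ ^ 2) = -((2 * σ ^ 2)⁻¹ * x) := fun x => by ring
      simp only [hj, hσ, if_false, if_true, Finset.mem_erase, ne_eq, not_false_eq_true,
        Finset.mem_univ, and_self, gw, this]

lemma entropy2_eq (i : Fin n) (a : Fin n → ℝ) (σ : ℝ) :
    entropy2 (gg (Finset.univ.erase i) a σ) =
      ent (Finset.univ.erase i) (gg (Finset.univ.erase i) a σ) / Real.log 2 := by
  unfold entropy2 ent
  rw [← Finset.sum_erase_add Finset.univ _ (Finset.mem_univ i), Finset.sum_div,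
    neg_add, ← Finset.sum_neg_distrib]
  have : gg (Finset.univ.erase i) a σ i = 0 := by simp [gg]
  rw [this, zero_mul, neg_zero, add_zero]
  refine Finset.sum_congr rfl fun j _ => ?_
  unfold Real.negMulLog Real.logb
  ring

lemma isCalibrated_iff [NormedAddCommGroup E] (X : Fin n → E) (ρ : ℝ) (i : Fin n) (σ : ℝ) :
    IsCalibrated X ρ i σ ↔
      Cal (Finset.univ.erase i) (fun j => ‖X i - X j‖ ^ 2) (Real.log ρ) σ := by
  unfold IsCalibrated Cal
  have h2 : 0 < Real.log 2 := Real.log_pos (by norm_num)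
  simp only [condAffinity_eq, entropy2_eq, Real.logb, ← sub_div, abs_div, abs_of_pos h2,
    div_le_div_iff_of_pos_right h2]

lemma sigmaStar_cal [NormedAddCommGroup E] (hn : 2 < n) (X : Fin n → E) {ρ : ℝ} (hρ : 1 < ρ)
    (hρ' : ρ < (n : ℝ) - 1) (i : Fin n) :
    Cal (Finset.univ.erase i) (fun j => ‖X i - X j‖ ^ 2) (Real.log ρ) (sigmaStar X ρ i) := by
  have hcard : (Finset.univ.erase i).card = n - 1 := by simp
  have hs : (Finset.univ.erase i).Nonempty := by
    rw [← Finset.card_pos, hcard]; omega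
  rw [← isCalibrated_iff]
  refine Classical.epsilon_spec (p := IsCalibrated X ρ i) ?_
  obtain ⟨σ, hσ⟩ := cal_exists hs (fun j => ‖X i - X j‖ ^ 2) (c := Real.log ρ) (by
    rw [hcard]
    refine Real.log_lt_log (by linarith) ?_
    rw [Nat.cast_sub (by omega)]
    simpa using hρ')
  exact ⟨σ, (isCalibrated_iff X ρ i σ).2 hσ⟩

lemma condAffinity_transfer [NormedAddCommGroup E] [NormedAddCommGroup F] (hn : 2 < n)
    (X : Fin n → E) (X' : Fin n → F) {ρ c t : ℝ} (hρ : 1 < ρ)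
    (hρ' : ρ < (n : ℝ) - 1) (ht : 0 < t)
    (hX : ∀ i j, i ≠ j → ‖X' i - X' j‖ ^ 2 = c + t ^ 2 * ‖X i - X j‖ ^ 2) (i : Fin n) :
    condAffinity X' (sigmaStar X' ρ i) i = condAffinity X (sigmaStar X ρ i) i := by
  have h1 := sigmaStar_cal hn X hρ hρ' i
  have h2 := sigmaStar_cal hn X' hρ hρ' i
  have hs : (Finset.univ.erase i).Nonempty := by
    rw [← Finset.card_pos]; simp; omega
  have key := gg_affine (s := Finset.univ.erase i) (a := fun j => ‖X i - X j‖ ^ 2)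
    (b := fun j => ‖X' i - X' j‖ ^ 2) (c := c) ht
    (fun j hj => hX i j (Finset.ne_of_mem_erase hj).symm)
  rw [condAffinity_eq, condAffinity_eq]
  have e : t * (sigmaStar X' ρ i / t) = sigmaStar X' ρ i := by field_simp
  have k1 := key (sigmaStar X' ρ i / t)
  rw [e] at k1
  rw [k1]
  refine cal_unique hs _ ⟨div_nonneg h2.1 ht.le, fun σ' hσ' => ?_⟩ h1
  rw [← k1, ← key σ']
  exact h2.2 _ (mul_nonneg ht.le hσ')

lemma TSNE_transfer [NormedAddCommGroup E] [NormedAddCommGroup F] (d : ℕ) (hn : 2 < n)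
    (X : Fin n → E) (X' : Fin n → F) {ρ c t : ℝ} (hρ : 1 < ρ)
    (hρ' : ρ < (n : ℝ) - 1) (ht : 0 < t)
    (hX : ∀ i j, i ≠ j → ‖X' i - X' j‖ ^ 2 = c + t ^ 2 * ‖X i - X j‖ ^ 2) :
    TSNE d ρ X' = TSNE d ρ X := by
  have h : inAffinity X' ρ = inAffinity X ρ := by
    funext i j
    unfold inAffinity
    rw [condAffinity_transfer hn X X' hρ hρ' ht hX i, condAffinity_transfer hn X X' hρ hρ' ht hX j]
  have h' : (tsneLoss X' ρ : (Fin n → EuclideanSpace ℝ (Fin d)) → ℝ) = tsneLoss X ρ := by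
    funext Y
    unfold tsneLoss
    rw [h]
  unfold TSNE
  rw [h']

/-! ### Embedding -/

lemma exists_embed {V : Type*} [NormedAddCommGroup V] [InnerProductSpace ℝ V]
    [FiniteDimensional ℝ V] {m : ℕ} (h : Module.finrank ℝ V ≤ m) :
    Nonempty (V →ₗᵢ[ℝ] EuclideanSpace ℝ (Fin m)) := by
  let b := stdOrthonormalBasis ℝ V
  let e := EuclideanSpace.basisFun (Fin m) ℝ
  let f : V →ₗ[ℝ] EuclideanSpace ℝ (Fin m) :=
    b.toBasis.constr ℝ (fun k => e (Fin.castLE h k))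
  refine ⟨f.isometryOfOrthonormal (v := b.toBasis) (by simp) ?_⟩
  have : f ∘ b.toBasis = e ∘ Fin.castLE h := by
    funext k
    simp only [Function.comp, f, Module.Basis.constr_basis]
  rw [this]
  exact e.orthonormal.comp _ (Fin.castLE_injective h)

lemma exists_points {V : Type*} [NormedAddCommGroup V] [InnerProductSpace ℝ V]
    (hn : 2 < n) (Z : Fin n → V) :
    ∃ X : Fin n → EuclideanSpace ℝ (Fin (n - 1)), ∀ i j, ‖X i - X j‖ = ‖Z i - Z j‖ := by
  let i0 : Fin n := ⟨0, by omega⟩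
  have hf : Module.finrank ℝ (vectorSpan ℝ (Set.range Z)) ≤ n - 1 :=
    finrank_vectorSpan_range_le ℝ Z (by simp; omega)
  obtain ⟨φ⟩ := exists_embed hf
  refine ⟨fun i => φ ⟨Z i - Z i0, vsub_mem_vectorSpan ℝ ⟨i, rfl⟩ ⟨i0, rfl⟩⟩, fun i j => ?_⟩
  rw [← map_sub, φ.norm_map]
  simp

lemma exists_perturb {m : ℕ} (hn : 2 < n) (X : Fin n → EuclideanSpace ℝ (Fin m)) (t : ℝ) :
    ∃ X' : Fin n → EuclideanSpace ℝ (Fin (n - 1)),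
      ∀ i j, i ≠ j → ‖X' i - X' j‖ ^ 2 = 1 + t ^ 2 * ‖X i - X j‖ ^ 2 := by
  obtain ⟨X', h⟩ := exists_points hn
    (fun i => (WithLp.toLp 2 ((√2)⁻¹ • EuclideanSpace.single i (1 : ℝ), t • X i) :
      WithLp 2 (EuclideanSpace ℝ (Fin n) × EuclideanSpace ℝ (Fin m))))
  refine ⟨X', fun i j hij => ?_⟩
  rw [h i j, WithLp.prod_norm_sq_eq_of_L2]
  change ‖(√2)⁻¹ • EuclideanSpace.single i (1 : ℝ) - (√2)⁻¹ • EuclideanSpace.single j (1 : ℝ)‖ ^ 2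
    + ‖t • X i - t • X j‖ ^ 2 = _
  rw [← smul_sub, ← smul_sub, norm_smul, norm_smul, mul_pow, mul_pow]
  have h1 : ‖(EuclideanSpace.single i (1 : ℝ) : EuclideanSpace ℝ (Fin n)) -
      EuclideanSpace.single j 1‖ ^ 2 = 2 := by
    rw [@norm_sub_sq_real]
    simp [EuclideanSpace.inner_single_left, hij]
    norm_num
  rw [h1]
  simp

/-- Lemma `image_of_tSNE`: the ε-perturbations of a regular unit simplex
already generate all stationary t-SNE outputs. -/
theorem image_of_tSNE (n d : ℕ) (hn : 2 < n) (hd : 1 ≤ d)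
    (ρ : ℝ) (hρ : 1 < ρ) (hρ' : ρ < (n : ℝ) - 1)
    (ε : ℝ) (hε : 0 < ε) :
    IMTSNE n d ρ =
      ⋃ X ∈ {X : Fin n → EuclideanSpace ℝ (Fin (n - 1)) |
          ∀ i j : Fin n, i ≠ j → ‖X i - X j‖ ^ 2 ∈ Set.Icc (1 - ε) (1 + ε)},
        TSNE d ρ X := by
  ext Y
  simp only [IMTSNE, Set.mem_iUnion, exists_prop]
  constructor
  · rintro ⟨X, hY⟩
    set M : ℝ := ∑ p : Fin n × Fin n, ‖X p.1 - X p.2‖ ^ 2 with hM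
    have hM0 : 0 ≤ M := Finset.sum_nonneg fun _ _ => by positivity
    have hle : ∀ i j, ‖X i - X j‖ ^ 2 ≤ M := by
      intro i j
      have h := Finset.single_le_sum (s := Finset.univ)
        (f := fun p : Fin n × Fin n => ‖X p.1 - X p.2‖ ^ 2)
        (fun p _ => sq_nonneg ‖X p.1 - X p.2‖) (Finset.mem_univ (i, j))
      rw [hM]
      exact h
    have hδ : 0 < ε / (M + 1) := by positivity
    clear_value M
    obtain ⟨X', hX'⟩ := exists_perturb hn X (√(ε / (M + 1)))
    refine ⟨X', fun i j hij => ?_, ?_⟩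
    · rw [hX' i j hij, Real.sq_sqrt hδ.le]
      have h1 : 0 ≤ ε / (M + 1) * ‖X i - X j‖ ^ 2 := by positivity
      have h2 : ε / (M + 1) * ‖X i - X j‖ ^ 2 ≤ ε := by
        rw [div_mul_eq_mul_div, div_le_iff₀ (by positivity)]
        exact mul_le_mul_of_nonneg_left ((hle i j).trans (by linarith)) hε.le
      constructor <;> linarith
    · rwa [TSNE_transfer d hn X X' hρ hρ' (Real.sqrt_pos.2 hδ) hX']
  · rintro ⟨X, _, hY⟩
    exact ⟨X, hY⟩

end TSNEPaper
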